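/- For every N ≥ 2, the normal-play unknown-coins games with one extra genuine coin satisfy G(F^+_N) = G(FI^+_N) = N; that is, both the find game and the find-and-identify game starting from N unknown coins plus an extra genuine coin are equivalent to normal-play Nim with a single pile of size N. -/

import Mathlib

/-!
A model of the counterfeit-coin weighing games.

There are `n` coins, indexed by `Fin n`, exactly one of which is counterfeit;
all genuine coins weigh the same, and the counterfeit is lighter or heavier
than a genuine coin according to its `FakeType`.  Each coin carries a
`CoinStatus` recording the Observer's knowledge about it:

* `excluded`: the Observer knows the coin is genuine;
* `light`   : destined to be lighter (if this coin is the counterfeit, it is lighter);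
* `heavy`   : destined to be heavier (if this coin is the counterfeit, it is heavier);
* `unknown` : the coin could be the counterfeit, either lighter or heavier.

Both players know the counterfeit coin and its type, and alternately perform
weighings: two disjoint sets of coins of equal size are put on the two pans of a
balance scale, and the outcome is determined by the truth.  After a balanced
weighing, the coins on the scale become excluded.  After an unbalanced weighing,
the coins off the scale become excluded; a coin on the lighter pan becomes
light-destined unless this contradicts its previous status (a heavy-destined
coin on the lighter pan becomes excluded); symmetrically for the heavier pan;
excluded coins stay excluded.  A weighing is legal iff the Observer gains some
new information, i.e. some coin changes status.

`Found P` says the Observer has found the counterfeit coin (exactly one coin is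
not excluded); `FoundAndIdentified P` says she has moreover identified it as
lighter or heavier.  In the game whose end condition is a goal `goal`, play
stops as soon as the goal is reached (`GMove goal`).  `NormalWin` is the
normal-play winning predicate for the player to move (the player unable to move
loses, so the player making the last legal weighing wins); `MisereWin` is the
misère-play winning predicate (the player whose weighing reveals the full
information, i.e. moves to a goal position, loses); `grundy` is the Grundy
(nim-)value: the `mex` of the Grundy values of the options, a position without
options having Grundy value `0`.  Since every legal weighing strictly decreases
the total hidden information `info P`, defining these by recursion with fuel
`info P` gives the correct values.
-/

/-- The Observer's knowledge about one coin. -/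
inductive CoinStatus : Type
  | excluded : CoinStatus
  | light    : CoinStatus
  | heavy    : CoinStatus
  | unknown  : CoinStatus
  deriving DecidableEq

/-- Whether the counterfeit coin is actually lighter or heavier than a genuine coin. -/
inductive FakeType : Type
  | light : FakeType
  | heavy : FakeType
  deriving DecidableEq

/-- The destiny status corresponding to the true type of the counterfeit coin. -/
def FakeType.destiny : FakeType → CoinStatus
  | FakeType.light => CoinStatus.light
  | FakeType.heavy => CoinStatus.heavy

/-- A position of the game: the statuses of the coins (the Observer's knowledge)
together with the identity and the true type of the counterfeit coin (which both
players know). -/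
structure Position (n : ℕ) : Type where
  status : Fin n → CoinStatus
  counterfeit : Fin n
  fakeType : FakeType

/-- Possible outcomes of a weighing. -/
inductive Outcome : Type
  | balanced | leftLighter | rightLighter
  deriving DecidableEq

/-- The truthful outcome of weighing pan `A` (left) against pan `B` (right):
it is determined by the location and the type of the counterfeit coin. -/
def outcome {n : ℕ} (P : Position n) (A B : Finset (Fin n)) : Outcome :=
  if P.counterfeit ∈ A then
    (match P.fakeType with
      | FakeType.light => Outcome.leftLighter
      | FakeType.heavy => Outcome.rightLighter)
  else if P.counterfeit ∈ B then
    (match P.fakeType with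
      | FakeType.light => Outcome.rightLighter
      | FakeType.heavy => Outcome.leftLighter)
  else Outcome.balanced

/-- New status of a coin that lay on the lighter pan of an unbalanced weighing. -/
def onLighterPan : CoinStatus → CoinStatus
  | CoinStatus.excluded => CoinStatus.excluded
  | CoinStatus.heavy => CoinStatus.excluded
  | _ => CoinStatus.light

/-- New status of a coin that lay on the heavier pan of an unbalanced weighing. -/
def onHeavierPan : CoinStatus → CoinStatus
  | CoinStatus.excluded => CoinStatus.excluded
  | CoinStatus.light => CoinStatus.excluded
  | _ => CoinStatus.heavy

/-- The statuses after weighing `A` against `B`. -/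
def updateStatus {n : ℕ} (P : Position n) (A B : Finset (Fin n)) (i : Fin n) :
    CoinStatus :=
  match outcome P A B with
  | Outcome.balanced =>
      if i ∈ A ∨ i ∈ B then CoinStatus.excluded else P.status i
  | Outcome.leftLighter =>
      if i ∈ A then onLighterPan (P.status i)
      else if i ∈ B then onHeavierPan (P.status i)
      else CoinStatus.excluded
  | Outcome.rightLighter =>
      if i ∈ B then onLighterPan (P.status i)
      else if i ∈ A then onHeavierPan (P.status i)
      else CoinStatus.excluded

/-- The position obtained from `P` by weighing pan `A` against pan `B`. -/
def weigh {n : ℕ} (P : Position n) (A B : Finset (Fin n)) : Position n :=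
  ⟨updateStatus P A B, P.counterfeit, P.fakeType⟩

/-- `Move P Q`: `Q` is obtained from `P` by one legal weighing, i.e. the two
pans are disjoint and carry equally many coins, and the Observer gains some new
information (some coin changes status). -/
def Move {n : ℕ} (P Q : Position n) : Prop :=
  ∃ A B : Finset (Fin n), Disjoint A B ∧ A.card = B.card ∧
    updateStatus P A B ≠ P.status ∧ Q = weigh P A B

/-- The set of coins currently having status `s`. -/
def statusSet {n : ℕ} (P : Position n) (s : CoinStatus) : Finset (Fin n) :=
  Finset.univ.filter fun i => P.status i = s

/-- The set of coins not yet known to be genuine. -/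
def nonExcluded {n : ℕ} (P : Position n) : Finset (Fin n) :=
  Finset.univ.filter fun i => P.status i ≠ CoinStatus.excluded

/-- The number of unknown coins. -/
def unknownCount {n : ℕ} (P : Position n) : ℕ :=
  (statusSet P CoinStatus.unknown).card

/-- The number of destined coins. -/
def destinedCount {n : ℕ} (P : Position n) : ℕ :=
  (statusSet P CoinStatus.light).card + (statusSet P CoinStatus.heavy).card

/-- The number of coins sharing the counterfeit coin's status, counting the
counterfeit coin itself. -/
def sameDestinyCount {n : ℕ} (P : Position n) : ℕ :=
  (Finset.univ.filter fun i => P.status i = P.status P.counterfeit).card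

/-- The Observer has found the counterfeit coin: exactly one coin is not excluded. -/
def Found {n : ℕ} (P : Position n) : Prop := (nonExcluded P).card = 1

/-- The Observer has found the counterfeit coin and knows whether it is lighter
or heavier. -/
def FoundAndIdentified {n : ℕ} (P : Position n) : Prop :=
  Found P ∧ P.status P.counterfeit ≠ CoinStatus.unknown

/-- Moves in the game whose end condition is `goal`: the game stops as soon as
the Observer's goal is reached, so no further weighings happen after that. -/
def GMove {n : ℕ} (goal : Position n → Prop) (P Q : Position n) : Prop :=
  ¬ goal P ∧ Move P Q

/-- The amount of information about one coin still hidden from the Observer. -/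
def statusWeight : CoinStatus → ℕ
  | CoinStatus.excluded => 0
  | CoinStatus.unknown => 2
  | _ => 1

/-- The total information still hidden from the Observer.  Every legal weighing
strictly decreases it, so it bounds the number of remaining moves. -/
def info {n : ℕ} (P : Position n) : ℕ := ∑ i, statusWeight (P.status i)

/-- Normal-play winning predicate, computed with fuel. -/
def NormalWinAux {n : ℕ} (moveRel : Position n → Position n → Prop) :
    ℕ → Position n → Prop
  | 0, _ => False
  | k + 1, P => ∃ Q, moveRel P Q ∧ ¬ NormalWinAux moveRel k Q

/-- The player to move wins under normal play: a player who has no legal move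
loses (so the player making the last legal weighing wins).  The fuel `info P`
suffices since every legal weighing strictly decreases `info`. -/
def NormalWin {n : ℕ} (moveRel : Position n → Position n → Prop)
    (P : Position n) : Prop :=
  NormalWinAux moveRel (info P) P

/-- Misère-play winning predicate, computed with fuel. -/
def MisereWinAux {n : ℕ} (moveRel : Position n → Position n → Prop)
    (goal : Position n → Prop) : ℕ → Position n → Prop
  | 0, P => goal P
  | k + 1, P => goal P ∨ ∃ Q, moveRel P Q ∧ ¬ MisereWinAux moveRel goal k Q

/-- The player to move wins under misère play: the player whose weighing
reveals the full information to the Observer (i.e. moves to a position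
satisfying `goal`) loses; equivalently, the player to move at a goal position
has already won.  A position is a P-position iff `MisereWin` fails there. -/
def MisereWin {n : ℕ} (moveRel : Position n → Position n → Prop)
    (goal : Position n → Prop) (P : Position n) : Prop :=
  MisereWinAux moveRel goal (info P) P

/-- Minimum excludant of a set of naturals. -/
noncomputable def mex (s : Set ℕ) : ℕ := sInf {k : ℕ | k ∉ s}

/-- Grundy values, computed with fuel. -/
noncomputable def grundyAux {n : ℕ} (moveRel : Position n → Position n → Prop) :
    ℕ → Position n → ℕ
  | 0, _ => 0
  | k + 1, P => mex {g : ℕ | ∃ Q, moveRel P Q ∧ grundyAux moveRel k Q = g}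

/-- The Grundy (nim-)value of a position: the `mex` of the Grundy values of the
positions reachable in one legal move; a position with no legal move has Grundy
value `0`.  The fuel `info P` suffices since every legal weighing strictly
decreases `info`. -/
noncomputable def grundy {n : ℕ} (moveRel : Position n → Position n → Prop)
    (P : Position n) : ℕ :=
  grundyAux moveRel (info P) P

/-- No coin is destined yet, the counterfeit is unknown, and some coin is known to be genuine. -/
def AllUnknown {n : ℕ} (P : Position n) : Prop :=
  (∃ e, P.status e = CoinStatus.excluded) ∧ P.status P.counterfeit = CoinStatus.unknown ∧
    ∀ i, P.status i = CoinStatus.unknown ∨ P.status i = CoinStatus.excluded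

/-- No coin is unknown any more, the counterfeit carries its true destiny, and some coin is known
to be genuine. -/
def AllDestined {n : ℕ} (P : Position n) : Prop :=
  (∃ e, P.status e = CoinStatus.excluded) ∧ P.status P.counterfeit = P.fakeType.destiny ∧
    ∀ i, P.status i ≠ CoinStatus.unknown

theorem mem_nonExcluded {n : ℕ} {P : Position n} {i : Fin n} :
    i ∈ nonExcluded P ↔ P.status i ≠ CoinStatus.excluded := by
  simp [nonExcluded]

theorem mex_le {s : Set ℕ} {m : ℕ} (h : m ∉ s) : mex s ≤ m :=
  Nat.sInf_le h

theorem mex_eq {s : Set ℕ} {m : ℕ} (h : m ∉ s) (hs : ∀ j < m, j ∈ s) : mex s = m := by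
  refine le_antisymm (mex_le h) (le_csInf ⟨m, h⟩ fun k hk => ?_)
  by_contra! hlt
  exact hk (hs k hlt)

/-- With one spare coin available, any set of coins can be put on the scale. -/
theorem exists_pans {α : Type*} [DecidableEq α] {S : Finset α} {e : α} (he : e ∉ S) :
    ∃ A B : Finset α, Disjoint A B ∧ A.card = B.card ∧ S ⊆ A ∪ B ∧ A ∪ B ⊆ insert e S := by
  have split : ∀ T : Finset α, Even T.card →
      ∃ A B : Finset α, Disjoint A B ∧ A.card = B.card ∧ A ∪ B = T := by
    rintro T ⟨r, hr⟩
    obtain ⟨A, hA, hAc⟩ := Finset.exists_subset_card_eq (show r ≤ T.card by omega)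
    refine ⟨A, T \ A, Finset.disjoint_sdiff, ?_, Finset.union_sdiff_of_subset hA⟩
    rw [Finset.card_sdiff_of_subset hA]
    omega
  rcases Nat.even_or_odd S.card with h | h
  · obtain ⟨A, B, hd, hc, hu⟩ := split S h
    exact ⟨A, B, hd, hc, hu.ge, hu.le.trans (Finset.subset_insert e S)⟩
  · obtain ⟨A, B, hd, hc, hu⟩ := split (insert e S) (by
      rw [Finset.card_insert_of_notMem he]; exact h.add_one)
    exact ⟨A, B, hd, hc, (Finset.subset_insert e S).trans hu.ge, hu.le⟩

theorem updateStatus_of_notMem {n : ℕ} (P : Position n) {A B : Finset (Fin n)}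
    (h : P.counterfeit ∉ A ∪ B) (i : Fin n) :
    updateStatus P A B i = if i ∈ A ∪ B then CoinStatus.excluded else P.status i := by
  simp only [Finset.mem_union, not_or] at h
  simp [updateStatus, outcome, h]

/-- A weighing never makes a coin known to be genuine suspicious again. -/
theorem updateStatus_excluded {n : ℕ} {P : Position n} {A B : Finset (Fin n)} {i : Fin n}
    (h : P.status i = CoinStatus.excluded) : updateStatus P A B i = CoinStatus.excluded := by
  unfold updateStatus
  split <;> split_ifs <;> simp_all [onLighterPan, onHeavierPan]

/-- A destined coin keeps its destiny or becomes excluded. -/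
theorem updateStatus_eq_or {n : ℕ} {P : Position n} {A B : Finset (Fin n)} {i : Fin n}
    (h : P.status i ≠ CoinStatus.unknown) :
    updateStatus P A B i = P.status i ∨ updateStatus P A B i = CoinStatus.excluded := by
  unfold updateStatus
  split <;> split_ifs <;> cases hs : P.status i <;> simp_all [onLighterPan, onHeavierPan]

theorem updateStatus_counterfeit {n : ℕ} {P : Position n} {A B : Finset (Fin n)}
    (hd : Disjoint A B)
    (h : P.status P.counterfeit = CoinStatus.unknown ∨
      P.status P.counterfeit = P.fakeType.destiny) (hm : P.counterfeit ∈ A ∪ B) :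
    updateStatus P A B P.counterfeit = P.fakeType.destiny := by
  have hd' : P.counterfeit ∈ A → P.counterfeit ∉ B := fun h => Finset.disjoint_left.1 hd h
  rw [Finset.mem_union] at hm
  by_cases hA : P.counterfeit ∈ A <;> by_cases hB : P.counterfeit ∈ B <;>
    rcases h with h | h <;> cases hf : P.fakeType <;>
    simp_all [updateStatus, outcome, onLighterPan, onHeavierPan, FakeType.destiny]

/-- In an unbalanced weighing every unknown coin on the scale acquires a destiny and every coin off
the scale is excluded. -/
theorem updateStatus_of_mem {n : ℕ} {P : Position n} {A B : Finset (Fin n)} {i : Fin n}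
    (hm : P.counterfeit ∈ A ∪ B)
    (h : P.status i = CoinStatus.unknown ∨ P.status i = CoinStatus.excluded) :
    updateStatus P A B i ≠ CoinStatus.unknown ∧
      (updateStatus P A B i ≠ CoinStatus.excluded ↔
        i ∈ A ∪ B ∧ P.status i ≠ CoinStatus.excluded) := by
  rw [Finset.mem_union] at hm
  by_cases hA : P.counterfeit ∈ A <;> by_cases hiA : i ∈ A <;> by_cases hiB : i ∈ B <;>
    rcases h with h | h <;> cases hf : P.fakeType <;>
    simp_all [updateStatus, outcome, onLighterPan, onHeavierPan]

theorem nonExcluded_weigh_subset {n : ℕ} (P : Position n) (A B : Finset (Fin n)) :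
    nonExcluded (weigh P A B) ⊆ nonExcluded P := by
  intro i hi
  rw [mem_nonExcluded] at *
  exact fun h => hi (updateStatus_excluded h)

/-- If a weighing that gives new information only excludes coins, then it excludes some coin. -/
theorem card_nonExcluded_weigh_lt {n : ℕ} {P : Position n} {A B : Finset (Fin n)}
    (hne : updateStatus P A B ≠ P.status)
    (h : ∀ i, updateStatus P A B i = P.status i ∨ updateStatus P A B i = CoinStatus.excluded) :
    (nonExcluded (weigh P A B)).card < (nonExcluded P).card := by
  obtain ⟨i, hi⟩ := Function.ne_iff.1 hne
  have hx := (h i).resolve_left hi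
  refine Finset.card_lt_card ((nonExcluded_weigh_subset P A B).ssubset_of_mem_notMem (a := i) ?_ ?_)
  · exact mem_nonExcluded.2 fun hs => hi (hx.trans hs.symm)
  · exact fun hm => mem_nonExcluded.1 hm hx

theorem AllDestined.of_move {n : ℕ} {P Q : Position n} (hP : AllDestined P) (hM : Move P Q) :
    AllDestined Q ∧ (nonExcluded Q).card < (nonExcluded P).card := by
  obtain ⟨⟨e, he⟩, hc, hall⟩ := hP
  obtain ⟨A, B, hd, -, hne, rfl⟩ := hM
  have hor := fun i => updateStatus_eq_or (A := A) (B := B) (hall i)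
  refine ⟨⟨⟨e, updateStatus_excluded he⟩, ?_, fun i => ?_⟩, card_nonExcluded_weigh_lt hne hor⟩
  · by_cases hm : P.counterfeit ∈ A ∪ B
    · exact updateStatus_counterfeit hd (Or.inr hc) hm
    · exact (updateStatus_of_notMem P hm _).trans ((if_neg hm).trans hc)
  · rcases hor i with h | h
    · exact h.trans_ne (hall i)
    · exact h.trans_ne (by decide)

theorem AllUnknown.of_move {n : ℕ} {P Q : Position n} (hP : AllUnknown P) (hM : Move P Q) :
    (AllUnknown Q ∧ (nonExcluded Q).card < (nonExcluded P).card) ∨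
      (AllDestined Q ∧ (nonExcluded Q).card ≤ (nonExcluded P).card) := by
  obtain ⟨⟨e, he⟩, hc, hall⟩ := hP
  obtain ⟨A, B, hd, -, hne, rfl⟩ := hM
  by_cases hm : P.counterfeit ∈ A ∪ B
  · exact Or.inr ⟨⟨⟨e, updateStatus_excluded he⟩, updateStatus_counterfeit hd (Or.inl hc) hm,
      fun i => (updateStatus_of_mem hm (hall i)).1⟩,
      Finset.card_le_card (nonExcluded_weigh_subset P A B)⟩
  · have hor : ∀ i, updateStatus P A B i = P.status i ∨
        updateStatus P A B i = CoinStatus.excluded := fun i => by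
      rw [updateStatus_of_notMem P hm]
      split_ifs <;> simp
    refine Or.inl ⟨⟨⟨e, updateStatus_excluded he⟩,
      (updateStatus_of_notMem P hm _).trans ((if_neg hm).trans hc), fun i => ?_⟩,
      card_nonExcluded_weigh_lt hne hor⟩
    rcases hor i with h | h
    · exact (hall i).imp h.trans h.trans
    · exact Or.inr h

theorem AllDestined.counterfeit_mem {n : ℕ} {P : Position n} (hP : AllDestined P) :
    P.counterfeit ∈ nonExcluded P := by
  rw [mem_nonExcluded, hP.2.1]
  cases P.fakeType <;> decide

theorem AllUnknown.counterfeit_mem {n : ℕ} {P : Position n} (hP : AllUnknown P) :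
    P.counterfeit ∈ nonExcluded P := by
  rw [mem_nonExcluded, hP.2.1]
  decide

/-- From a position with destined coins, any smaller number of suspects can be reached. -/
theorem AllDestined.exists_move {n : ℕ} {P : Position n} (hP : AllDestined P) {j : ℕ}
    (hj : j < (nonExcluded P).card - 1) : ∃ Q, Move P Q ∧ (nonExcluded Q).card = j + 1 := by
  obtain ⟨e, he⟩ := hP.1
  have hcm := hP.counterfeit_mem
  obtain ⟨S, hS, hSc⟩ := Finset.exists_subset_card_eq
    (s := (nonExcluded P).erase P.counterfeit) (n := (nonExcluded P).card - 1 - j)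
    (by rw [Finset.card_erase_of_mem hcm]; omega)
  have hSP : S ⊆ nonExcluded P := hS.trans (Finset.erase_subset _ _)
  have heP : e ∉ nonExcluded P := by simp [mem_nonExcluded, he]
  obtain ⟨A, B, hd, hc, hl, hr⟩ := exists_pans fun h => heP (hSP h)
  have hm : P.counterfeit ∉ A ∪ B := fun h => by
    rcases Finset.mem_insert.1 (hr h) with h | h
    · exact heP (h ▸ hcm)
    · exact Finset.notMem_erase _ _ (hS h)
  have hQ : nonExcluded (weigh P A B) = nonExcluded P \ S := by
    ext i
    have hi : (weigh P A B).status i = _ := updateStatus_of_notMem P hm i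
    rw [Finset.mem_sdiff, mem_nonExcluded, mem_nonExcluded, hi]
    split_ifs with h
    · rcases Finset.mem_insert.1 (hr h) with rfl | h
      · simp [he]
      · simp [h]
    · exact (and_iff_left fun h' => h (hl h')).symm
  have hcard : (nonExcluded (weigh P A B)).card = j + 1 := by
    rw [hQ, Finset.card_sdiff_of_subset hSP]
    omega
  refine ⟨_, ⟨A, B, hd, hc, fun h => ?_, rfl⟩, hcard⟩
  have : nonExcluded (weigh P A B) = nonExcluded P := by
    ext i
    rw [mem_nonExcluded, mem_nonExcluded, ← h]
    rfl
  rw [this] at hcard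
  omega

/-- From a position without destined coins, any positive number of suspects, not exceeding the
current one, can be reached by an unbalanced weighing. -/
theorem AllUnknown.exists_move {n : ℕ} {P : Position n} (hP : AllUnknown P) {j : ℕ}
    (hj : j < (nonExcluded P).card) :
    ∃ Q, Move P Q ∧ AllDestined Q ∧ (nonExcluded Q).card = j + 1 := by
  obtain ⟨e, he⟩ := hP.1
  obtain ⟨S, hS, hSP, hSc⟩ := Finset.exists_subsuperset_card_eq
    (Finset.singleton_subset_iff.2 hP.counterfeit_mem) (n := j + 1) (by simp) hj
  have heP : e ∉ nonExcluded P := by simp [mem_nonExcluded, he]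
  obtain ⟨A, B, hd, hc, hl, hr⟩ := exists_pans fun h => heP (hSP h)
  have hm : P.counterfeit ∈ A ∪ B := hl (Finset.singleton_subset_iff.1 hS)
  have hcf := updateStatus_counterfeit hd (Or.inl hP.2.1) hm
  have hQ : nonExcluded (weigh P A B) = S := by
    ext i
    rw [mem_nonExcluded]
    refine (updateStatus_of_mem hm (hP.2.2 i)).2.trans ⟨fun ⟨h, hi⟩ => ?_, fun h =>
      ⟨hl h, mem_nonExcluded.1 (hSP h)⟩⟩
    rcases Finset.mem_insert.1 (hr h) with rfl | h
    · exact absurd he hi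
    · exact h
  refine ⟨_, ⟨A, B, hd, hc, fun h => ?_, rfl⟩, ⟨⟨e, updateStatus_excluded he⟩, hcf,
    fun i => (updateStatus_of_mem hm (hP.2.2 i)).1⟩, hQ ▸ hSc⟩
  rw [h, hP.2.1] at hcf
  cases hf : P.fakeType <;> simp [hf, FakeType.destiny] at hcf

theorem grundyAux_allDestined {n : ℕ} {goal : Position n → Prop}
    (hF : ∀ P, goal P → Found P) :
    ∀ (k : ℕ) (P : Position n), AllDestined P → (nonExcluded P).card - 1 ≤ k →
      grundyAux (GMove goal) k P = (nonExcluded P).card - 1 := by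
  intro k
  induction k with
  | zero => exact fun P _ hk => (Nat.le_zero.1 hk).symm
  | succ k ih =>
    intro P hP hk
    refine mex_eq ?_ fun j hj => ?_
    · rintro ⟨Q, ⟨hg, hM⟩, hQ⟩
      obtain ⟨hQD, hlt⟩ := hP.of_move hM
      have h0 := Finset.card_pos.2 ⟨_, hQD.counterfeit_mem⟩
      rw [ih Q hQD (by omega)] at hQ
      omega
    · obtain ⟨Q, hM, hQ⟩ := hP.exists_move hj
      refine ⟨Q, ⟨fun hg => ?_, hM⟩, ?_⟩
      · have : (nonExcluded P).card = 1 := hF P hg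
        omega
      · rw [ih Q (hP.of_move hM).1 (by omega), hQ, Nat.add_sub_cancel]

theorem grundyAux_allUnknown {n : ℕ} {goal : Position n → Prop}
    (hF : ∀ P, goal P → Found P) :
    ∀ (k : ℕ) (P : Position n), AllUnknown P → (nonExcluded P).card ≤ k →
      grundyAux (GMove goal) k P ≤ (nonExcluded P).card ∧
        (2 ≤ (nonExcluded P).card → grundyAux (GMove goal) k P = (nonExcluded P).card) := by
  intro k
  induction k with
  | zero => exact fun P _ hk => ⟨Nat.zero_le _, fun h => by omega⟩
  | succ k ih =>
    intro P hP hk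
    have hnot : (nonExcluded P).card ∉
        {g : ℕ | ∃ Q, GMove goal P Q ∧ grundyAux (GMove goal) k Q = g} := by
      rintro ⟨Q, ⟨-, hM⟩, hQ⟩
      rcases hP.of_move hM with ⟨hQU, hlt⟩ | ⟨hQD, hle⟩
      · have := (ih Q hQU (by omega)).1
        omega
      · have h0 := Finset.card_pos.2 ⟨_, hQD.counterfeit_mem⟩
        rw [grundyAux_allDestined hF k Q hQD (by omega)] at hQ
        omega
    refine ⟨mex_le hnot, fun h2 => mex_eq hnot fun j hj => ?_⟩
    obtain ⟨Q, hM, hQD, hQ⟩ := hP.exists_move hj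
    refine ⟨Q, ⟨fun hg => ?_, hM⟩, ?_⟩
    · have : (nonExcluded P).card = 1 := hF P hg
      omega
    · rw [grundyAux_allDestined hF k Q hQD (by omega), hQ, Nat.add_sub_cancel]

theorem card_nonExcluded_le_info {n : ℕ} (P : Position n) : (nonExcluded P).card ≤ info P := by
  rw [nonExcluded, Finset.card_filter]
  refine Finset.sum_le_sum fun i _ => ?_
  cases P.status i <;> simp [statusWeight]

/-- For every `N ≥ 2`, the normal-play unknown-coins games
with one extra genuine coin satisfy `G(F⁺_N) = G(FI⁺_N) = N`: both the find
game and the find-and-identify game starting from `N` unknown coins plus an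
extra genuine coin are equivalent to normal-play Nim with a single pile of
size `N`. -/
theorem grundy_unknown_extra_normal {n N : ℕ} (P : Position n) (hN : 2 ≤ N)
    (hu : unknownCount P = N)
    (he : (statusSet P CoinStatus.excluded).card = 1)
    (hall : ∀ i, P.status i = CoinStatus.unknown ∨ P.status i = CoinStatus.excluded)
    (hcf : P.status P.counterfeit = CoinStatus.unknown) :
    grundy (GMove Found) P = N ∧ grundy (GMove FoundAndIdentified) P = N := by
  have hP : AllUnknown P := by
    obtain ⟨e, hmem⟩ := Finset.card_pos.1 (he ▸ Nat.one_pos)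
    exact ⟨⟨e, (Finset.mem_filter.1 hmem).2⟩, hcf, hall⟩
  have hN' : (nonExcluded P).card = N := by
    rw [← hu, unknownCount]
    congr 1
    ext i
    rw [mem_nonExcluded, statusSet, Finset.mem_filter]
    rcases hall i with h | h <;> simp [h]
  have key : ∀ goal : Position n → Prop, (∀ P, goal P → Found P) → grundy (GMove goal) P = N :=
    fun goal hF => hN' ▸ (grundyAux_allUnknown hF _ P hP (card_nonExcluded_le_info P)).2
      (hN' ▸ hN)
  exact ⟨key _ fun _ h => h, key _ fun _ h => h.1⟩
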